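/- Let G = *_{i∈I} G_i be a free product of at least two nontrivial groups. The palindromic width of G (with respect to the palindromes associated with this free factorization) is infinite if and only if some free factor has more than two elements or there are at least three free factors; in the remaining case (the free product of two cyclic groups of order two) the palindromic width equals two. -/

import Mathlib

open Monoid Monoid.CoprodI

attribute [local instance] Classical.propDecidable

/-- The list of syllables of the reduced word representing `g`. -/
noncomputable def syllables {ι : Type*} {M : ι → Type*} [∀ i, Group (M i)]
    (g : CoprodI M) : List (Σ i, M i) :=
  letI := Classical.decEq ι
  letI : ∀ i, DecidableEq (M i) := fun _ => Classical.decEq _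
  (Word.equiv g).toList

/-- `g` is a palindrome iff its reduced word reads the same backwards. -/
noncomputable def IsPalindrome {ι : Type*} {M : ι → Type*} [∀ i, Group (M i)]
    (g : CoprodI M) : Prop :=
  (syllables g).reverse = syllables g
/-- `G` has palindromic width at most `k` : every element is a product of at
most `k` palindromes. -/
noncomputable def PalWidthLe {ι : Type*} {M : ι → Type*} [∀ i, Group (M i)] (k : ℕ) : Prop :=
  ∀ g : CoprodI M, ∃ L : List (CoprodI M),
    L.length ≤ k ∧ (∀ p ∈ L, IsPalindrome p) ∧ L.prod = g

namespace PalW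

section comb
variable {α β : Type*}

/-- The pattern test on the first nine letters. -/
def Pat (l : List α) : Prop :=
  8 < l.length ∧ l[0]? ≠ l[2]? ∧ l[2]? ≠ l[4]? ∧ l[4]? = l[6]? ∧ l[6]? ≠ l[8]?

/-- The number of occurrences of the pattern. -/
noncomputable def cnt : List α → ℤ
  | [] => 0
  | x :: l => (if Pat (x :: l) then 1 else 0) + cnt l

lemma Pat_append (l m : List α) (h : 8 < l.length) : Pat (l ++ m) ↔ Pat l := by
  unfold Pat
  rw [List.getElem?_append_left (by omega), List.getElem?_append_left (by omega),
    List.getElem?_append_left (by omega), List.getElem?_append_left (by omega),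
    List.getElem?_append_left (by omega), List.length_append]
  have : 8 < l.length + m.length := by omega
  tauto

lemma cnt_append (l m : List α) :
    |cnt (l ++ m) - cnt l - cnt m| ≤ min (l.length : ℤ) 8 := by
  induction l with
  | nil => simp [cnt]
  | cons x l ih =>
    by_cases h : 8 < (x :: l).length
    · have e := Pat_append (x :: l) m h
      have h2 : cnt (x :: l ++ m) - cnt (x :: l) - cnt m = cnt (l ++ m) - cnt l - cnt m := by
        rw [List.cons_append] at *
        simp only [cnt, e]
        ring
      rw [h2]
      simp only [List.length_cons] at *
      push_cast
      omega
    · have h1 : ¬ Pat (x :: l) := fun hp => h hp.1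
      simp only [List.cons_append, cnt, h1, if_false]
      simp only [List.length_cons] at *
      push_cast
      rw [abs_le] at *
      split_ifs <;> omega

lemma Pat_map (φ : α → β) (hφ : Function.Injective φ) (l : List α) : Pat (l.map φ) ↔ Pat l := by
  have := Option.map_injective hφ
  simp only [Pat, List.length_map, List.getElem?_map, ne_eq, this.eq_iff]

lemma cnt_map (φ : α → β) (hφ : Function.Injective φ) (l : List α) : cnt (l.map φ) = cnt l := by
  induction l with
  | nil => rfl
  | cons x l ih =>
    have := Pat_map φ hφ (x :: l)
    rw [List.map_cons] at *
    simp only [cnt, this, ih]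

/-- Antisymmetrised count. -/
noncomputable def ff (l : List α) : ℤ := cnt l - cnt l.reverse

lemma ff_append (l m : List α) : |ff (l ++ m) - ff l - ff m| ≤ 16 := by
  have h1 := cnt_append l m
  have h2 := cnt_append m.reverse l.reverse
  unfold ff
  rw [List.reverse_append]
  rw [abs_le] at *
  omega

lemma ff_reverse (l : List α) : ff l.reverse = - ff l := by
  simp [ff]

lemma ff_map (φ : α → β) (hφ : Function.Injective φ) (l : List α) : ff (l.map φ) = ff l := by
  simp only [ff, ← List.map_reverse, cnt_map φ hφ]

lemma ff_short (l : List α) (h : l.length ≤ 1) : ff l = 0 := by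
  rcases l with _ | ⟨x, _ | ⟨y, l⟩⟩
  · simp [ff]
  · simp [ff]
  · simp at h

/-- The repeated block. -/
def blk (s t u : α) : List α := [s, u, t, u, s, u, t, u, t, u, s, u, s, u]

/-- The test words. -/
def tw (s t u : α) : ℕ → List α
  | 0 => []
  | n + 1 => blk s t u ++ tw s t u n

/-- The reversed test words. -/
def rtw (s t u : α) : ℕ → List α
  | 0 => []
  | n + 1 => (blk s t u).reverse ++ rtw s t u n

lemma rtw_comm (s t u : α) (n : ℕ) :
    (blk s t u).reverse ++ rtw s t u n = rtw s t u n ++ (blk s t u).reverse := by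
  induction n with
  | zero => simp [rtw]
  | succ n ih =>
    rw [rtw, List.append_assoc, ← ih]

lemma tw_reverse (s t u : α) (n : ℕ) : (tw s t u n).reverse = rtw s t u n := by
  induction n with
  | zero => rfl
  | succ n ih => rw [tw, rtw, List.reverse_append, ih, rtw_comm]

lemma cnt_tw (s t u : α) (h : s ≠ t) (n : ℕ) : cnt (tw s t u (n + 1)) = n + 1 := by
  have h' := h.symm
  induction n with
  | zero => simp [tw, blk, cnt, Pat, h, h']
  | succ n ih =>
    have : cnt (tw s t u (n + 2)) = 1 + cnt (tw s t u (n + 1)) := by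
      simp only [tw]
      generalize tw s t u n = R
      simp [blk, cnt, Pat, h, h']
    rw [this, ih]; push_cast; ring

lemma cnt_rtw (s t u : α) (h : s ≠ t) (n : ℕ) : cnt (rtw s t u (n + 1)) = 0 := by
  have h' := h.symm
  induction n with
  | zero => simp [rtw, blk, cnt, Pat, h, h']
  | succ n ih =>
    have : cnt (rtw s t u (n + 2)) = cnt (rtw s t u (n + 1)) := by
      simp only [rtw]
      generalize rtw s t u n = R
      simp [blk, cnt, Pat, h, h']
    rw [this, ih]

lemma ff_tw (s t u : α) (h : s ≠ t) (n : ℕ) : ff (tw s t u (n + 1)) = n + 1 := by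
  rw [ff, tw_reverse, cnt_tw s t u h, cnt_rtw s t u h, sub_zero]

end comb

section grp
variable {ι : Type*} {M : ι → Type*} [∀ i, Group (M i)]

/-- Reduced lists. -/
def Red (l : List (Σ i, M i)) : Prop :=
  (∀ x ∈ l, x.2 ≠ 1) ∧ l.IsChain (fun a b => a.1 ≠ b.1)

/-- Value of a list. -/
def val (l : List (Σ i, M i)) : CoprodI M := (l.map (fun x => (of x.2 : CoprodI M))).prod

lemma red_syllables (g : CoprodI M) : Red (syllables g) := by
  unfold syllables
  exact ⟨fun x hx => (Word.equiv g).ne_one x hx, (Word.equiv g).chain_ne⟩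

lemma val_syllables (g : CoprodI M) : val (syllables g) = g := by
  unfold syllables
  letI := Classical.decEq ι
  letI : ∀ i, DecidableEq (M i) := fun _ => Classical.decEq _
  exact Word.equiv.symm_apply_apply g

lemma syllables_val (l : List (Σ i, M i)) (h : Red l) : syllables (val l) = l := by
  unfold syllables
  letI := Classical.decEq ι
  letI : ∀ i, DecidableEq (M i) := fun _ => Classical.decEq _
  exact congrArg Word.toList (Word.equiv.apply_symm_apply (⟨l, fun x hx => h.1 x hx, h.2⟩ : Word M))

lemma val_append (l m : List (Σ i, M i)) : val (l ++ m) = val l * val m := by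
  simp [val]

/-- Inverse of a syllable. -/
def sinv (x : Σ i, M i) : Σ i, M i := ⟨x.1, x.2⁻¹⟩

lemma sinv_inj : Function.Injective (sinv : (Σ i, M i) → Σ i, M i) := by
  rintro ⟨i, x⟩ ⟨j, y⟩ h
  simp only [sinv, Sigma.mk.injEq] at h
  obtain ⟨rfl, h⟩ := h
  simpa using h

lemma structure_lemma (l₁ : List (Σ i, M i)) : ∀ l₂ : List (Σ i, M i), Red l₁ → Red l₂ →
    ∃ A k B m₁ m₂ m₃ : List (Σ i, M i), l₁ = A ++ (m₁ ++ k) ∧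
      l₂ = (k.map sinv).reverse ++ (m₂ ++ B) ∧
      Red (A ++ (m₃ ++ B)) ∧ val l₁ * val l₂ = val (A ++ (m₃ ++ B)) ∧
      m₁.length ≤ 1 ∧ m₂.length ≤ 1 ∧ m₃.length ≤ 1 := by
  induction l₁ using List.reverseRecOn with
  | nil =>
    intro l₂ _ h₂
    exact ⟨[], [], l₂, [], [], [], by simp, by simp, by simpa using h₂, by simp [val],
      by simp, by simp, by simp⟩
  | append_singleton l x ih =>
    intro l₂ h₁ h₂
    rcases l₂ with _ | ⟨y, l₂⟩
    · exact ⟨l ++ [x], [], [], [], [], [], by simp, by simp, by simpa using h₁, by simp [val],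
        by simp, by simp, by simp⟩
    have hl : Red l := ⟨fun z hz => h₁.1 z (by simp [hz]), h₁.2.left_of_append⟩
    have hl₂ : Red l₂ := ⟨fun z hz => h₂.1 z (by simp [hz]), h₂.2.tail⟩
    obtain ⟨i, x⟩ := x
    obtain ⟨j, y⟩ := y
    have hc1 := h₁.2
    have hc2 := h₂.2
    rw [List.isChain_append] at hc1
    rw [List.isChain_cons] at hc2
    by_cases hij : i = j
    · subst hij
      by_cases hxy : x * y = 1
      · obtain ⟨A, k, B, m₁, m₂, m₃, e1, e2, hr, hv, a1, a2, a3⟩ := ih l₂ hl hl₂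
        refine ⟨A, k ++ [⟨i, x⟩], B, m₁, m₂, m₃, by rw [e1]; simp, ?_, hr, ?_, a1, a2, a3⟩
        · have : y = x⁻¹ := (inv_eq_of_mul_eq_one_right hxy).symm
          rw [e2, this]; simp [sinv]
        · rw [← hv, val_append, mul_assoc, ← val_append]
          congr 1
          have : (of x : CoprodI M) * of y = 1 := by rw [← map_mul, hxy, map_one]
          simp [val, ← mul_assoc, this]
      · refine ⟨l, [], l₂, [⟨i, x⟩], [⟨i, y⟩], [⟨i, x * y⟩], by simp, by simp, ⟨?_, ?_⟩, ?_,
          by simp, by simp, by simp⟩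
        · intro z hz
          simp only [List.mem_append, List.mem_cons, List.not_mem_nil, or_false] at hz
          rcases hz with hz | rfl | hz
          · exact hl.1 z hz
          · exact hxy
          · exact hl₂.1 z hz
        · rw [List.isChain_append]
          refine ⟨hl.2, ?_, ?_⟩
          · rw [List.singleton_append, List.isChain_cons]
            exact ⟨fun z hz => hc2.1 z hz, hl₂.2⟩
          · intro z hz w hw
            simp only [List.singleton_append, List.head?_cons, Option.mem_def,
              Option.some.injEq] at hw
            subst hw
            exact hc1.2.2 z hz ⟨i, x⟩ (by simp)
        · simp [val, mul_assoc]
    · refine ⟨l ++ [⟨i, x⟩], [], ⟨j, y⟩ :: l₂, [], [], [], by simp, by simp, ⟨?_, ?_⟩, ?_,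
          by simp, by simp, by simp⟩
      · intro z hz
        rw [List.nil_append, List.mem_append] at hz
        exact hz.elim (h₁.1 z) (h₂.1 z)
      · rw [List.nil_append, List.isChain_append]
        refine ⟨h₁.2, h₂.2, ?_⟩
        intro z hz w hw
        simp at hz hw
        subst hz hw
        exact hij
      · rw [List.nil_append, val_append (l ++ _)]

/-- The quasimorphism. -/
noncomputable def FF (g : CoprodI M) : ℤ := ff (syllables g)

lemma FF_mul (g h : CoprodI M) : |FF (g * h) - FF g - FF h| ≤ 96 := by
  obtain ⟨A, k, B, m₁, m₂, m₃, e1, e2, hr, hv, a1, a2, a3⟩ :=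
    structure_lemma (syllables g) (syllables h) (red_syllables g) (red_syllables h)
  rw [val_syllables, val_syllables] at hv
  unfold FF
  rw [hv, syllables_val _ hr, e1, e2]
  have b1 := ff_append A (m₁ ++ k)
  have b2 := ff_append m₁ k
  have b3 := ff_append (k.map sinv).reverse (m₂ ++ B)
  have b4 := ff_append m₂ B
  have b5 := ff_append A (m₃ ++ B)
  have b6 := ff_append m₃ B
  rw [ff_short _ a1] at b2
  rw [ff_short _ a2] at b4
  rw [ff_short _ a3] at b6
  have c : ff (k.map sinv).reverse = - ff k := by rw [ff_reverse, ff_map _ sinv_inj]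
  rw [c] at b3
  rw [abs_le] at *
  omega

lemma FF_pal (g : CoprodI M) (h : IsPalindrome g) : FF g = 0 := by
  unfold FF ff
  rw [h, sub_self]

lemma FF_one : FF (1 : CoprodI M) = 0 := by
  have h : Red ([] : List (Σ i, M i)) := ⟨by simp, by simp⟩
  have : syllables (1 : CoprodI M) = [] := by simpa [val] using syllables_val _ h
  simp [FF, this, ff]

lemma FF_prod (L : List (CoprodI M)) (h : ∀ p ∈ L, IsPalindrome p) :
    |FF L.prod| ≤ 96 * L.length := by
  induction L with
  | nil => simp [FF_one]
  | cons p L ih =>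
    have h1 := ih fun q hq => h q (by simp [hq])
    have h2 := FF_mul p L.prod
    rw [FF_pal p (h p (by simp))] at h2
    rw [List.prod_cons, List.length_cons]
    push_cast
    rw [abs_le] at *
    constructor <;> linarith

lemma red_tw (s t u : Σ i, M i) (hs : s.2 ≠ 1) (ht : t.2 ≠ 1) (hu : u.2 ≠ 1)
    (h1 : s.1 ≠ u.1) (h2 : t.1 ≠ u.1) (n : ℕ) : Red (tw s t u n) := by
  have h1' := h1.symm
  have h2' := h2.symm
  induction n with
  | zero => exact ⟨by simp [tw], by simp [tw]⟩
  | succ n ih =>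
    refine ⟨?_, ?_⟩
    · intro z hz
      rw [tw, List.mem_append] at hz
      rcases hz with hz | hz
      · simp only [blk, List.mem_cons, List.not_mem_nil, or_false] at hz
        rcases hz with h | h | h | h | h | h | h | h | h | h | h | h | h | h <;>
          rw [h] <;> assumption
      · exact ih.1 z hz
    · rw [tw, List.isChain_append]
      refine ⟨by simp [blk, h1, h2, h1', h2'], ih.2, ?_⟩
      intro x hx y hy
      have hx : u = x := by simpa [blk] using hx
      subst hx
      cases n with
      | zero => simp [tw] at hy
      | succ n =>
        have hy : s = y := by simpa [tw, blk] using hy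
        subst hy
        exact h1'

lemma infinite_width (s t u : Σ i, M i) (hs : s.2 ≠ 1) (ht : t.2 ≠ 1) (hu : u.2 ≠ 1)
    (h1 : s.1 ≠ u.1) (h2 : t.1 ≠ u.1) (hst : s ≠ t) (k : ℕ) : ¬ PalWidthLe (M := M) k := by
  intro h
  obtain ⟨L, hL, hp, e⟩ := h (val (tw s t u (96 * k + 1 + 1)))
  have := FF_prod L hp
  rw [e, FF, syllables_val _ (red_tw s t u hs ht hu h1 h2 _), ff_tw s t u hst] at this
  rw [abs_le] at this
  push_cast at this
  omega

lemma odd_pal (hι : ∀ i j k : ι, i ≠ j → k ≠ j → i = k)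
    (hM : ∀ i, ∀ x y : M i, x ≠ 1 → y ≠ 1 → x = y)
    (l : List (Σ i, M i)) (h : Red l) (ho : Odd l.length) : l.reverse = l := by
  have key : ∀ i (hi : i < l.length), (l[i].1 = (l[0]'(by omega)).1 ↔ Even i) := by
    intro i
    induction i with
    | zero => simp
    | succ i ih =>
      intro hi
      have a := ih (by omega)
      have b := List.isChain_iff_getElem.1 h.2 i (by omega)
      rw [Nat.even_add_one, ← a]
      constructor
      · intro e e'
        exact b (e'.trans e.symm)
      · intro e
        exact hι _ _ _ (Ne.symm b) (Ne.symm e)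
  refine List.ext_getElem (by simp) fun i h1 h2 => ?_
  rw [List.getElem_reverse]
  have k1 := key i h2
  have k2 := key (l.length - 1 - i) (by omega)
  have hpar : Even (l.length - 1 - i) ↔ Even i := by
    obtain ⟨m, hm⟩ := ho
    rw [Nat.even_iff, Nat.even_iff]
    omega
  have hidx : (l[l.length - 1 - i]'(by omega)).1 = l[i].1 := by
    by_cases he : Even i
    · rw [k1.2 he, k2.2 (hpar.2 he)]
    · exact hι _ _ _ (fun e => he (hpar.1 (k2.1 e))) (fun e => he (k1.1 e))
  have n1 := h.1 _ (List.getElem_mem h2)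
  have n2 := h.1 _ (List.getElem_mem (show l.length - 1 - i < l.length by omega))
  generalize l[l.length - 1 - i]'(by omega) = p at *
  generalize l[i] = q at *
  obtain ⟨i', x⟩ := p
  obtain ⟨j', y⟩ := q
  simp only at hidx
  subst hidx
  rw [hM _ x y n2 n1]

lemma width_two (hι : ∀ i j k : ι, i ≠ j → k ≠ j → i = k)
    (hM : ∀ i, ∀ x y : M i, x ≠ 1 → y ≠ 1 → x = y) : PalWidthLe (M := M) 2 := by
  have pal : ∀ l : List (Σ i, M i), Red l → Odd l.length → IsPalindrome (val l) := by
    intro l h ho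
    rw [IsPalindrome, syllables_val l h]
    exact odd_pal hι hM l h ho
  intro g
  have hr := red_syllables g
  have hv := val_syllables g
  generalize syllables g = l at *
  by_cases ho : Odd l.length
  · exact ⟨[val l], by simp, by simpa using pal l hr ho, by simpa using hv⟩
  · rcases l with _ | ⟨x, l⟩
    · exact ⟨[], by simp, by simp, by simpa [val] using hv⟩
    · have r1 : Red [x] := ⟨fun z hz => hr.1 z (by simp_all), by simp⟩
      have r2 : Red l := ⟨fun z hz => hr.1 z (by simp [hz]), hr.2.tail⟩
      refine ⟨[val [x], val l], by simp, ?_, ?_⟩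
      · intro p hp
        simp only [List.mem_cons, List.not_mem_nil, or_false] at hp
        rcases hp with rfl | rfl
        · exact pal _ r1 (by simp)
        · refine pal _ r2 ?_
          rw [List.length_cons, Nat.odd_add_one, not_not] at ho
          exact ho
      · rw [← hv]; simp [val]

lemma not_width_one (s t : Σ i, M i) (hs : s.2 ≠ 1) (ht : t.2 ≠ 1) (h : s.1 ≠ t.1) :
    ¬ PalWidthLe (M := M) 1 := by
  intro hw
  have hr : Red [s, t] := ⟨by simp [hs, ht], by simp [h]⟩
  have hsy := syllables_val _ hr
  have hnp : ¬ IsPalindrome (val [s, t]) := by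
    rw [IsPalindrome, hsy]
    intro e
    simp at e
    exact h (congrArg Sigma.fst e.2)
  obtain ⟨L, hL, hp, e⟩ := hw (val [s, t])
  rcases L with _ | ⟨p, _ | ⟨q, L⟩⟩
  · apply hnp
    rw [← e]
    have h0 : Red ([] : List (Σ i, M i)) := ⟨by simp, by simp⟩
    have : syllables (1 : CoprodI M) = [] := by simpa [val] using syllables_val _ h0
    simp [IsPalindrome, this]
  · apply hnp
    rw [← e]
    simpa using hp p (by simp)
  · simp at hL

end grp

lemma three_le_of {α : Type*} (x y z : α) (h1 : x ≠ y) (h2 : x ≠ z) (h3 : y ≠ z) :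
    3 ≤ Cardinal.mk α := by
  have hf : Function.Injective ![x, y, z] := by
    intro i j
    fin_cases i <;> fin_cases j <;> simp [h1, h2, h3, h1.symm, h2.symm, h3.symm]
  have := Cardinal.mk_le_of_injective (α := ULift (Fin 3)) (β := α) (f := fun i => ![x, y, z] i.down)
    (hf.comp ULift.down_injective)
  simpa using this

end PalW

/-- The palindromic width of a free product of at least two nontrivial groups is
infinite iff some factor has more than two elements or there are at least three
factors; in the remaining case (two factors of order two) the width is two. -/
theorem palindromic_width_of_free_product {ι : Type*} {M : ι → Type*} [∀ i, Group (M i)]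
    [∀ i, Nontrivial (M i)] (hι : 2 ≤ Cardinal.mk ι) :
    ((∀ k : ℕ, ¬ PalWidthLe (M := M) k) ↔
      ((∃ i, 3 ≤ Cardinal.mk (M i)) ∨ 3 ≤ Cardinal.mk ι)) ∧
    (¬ ((∃ i, 3 ≤ Cardinal.mk (M i)) ∨ 3 ≤ Cardinal.mk ι) →
      PalWidthLe (M := M) 2 ∧ ¬ PalWidthLe (M := M) 1) := by
  have two := Cardinal.two_le_iff.1 hι
  obtain ⟨i₀, j₀, hij⟩ := two
  have hne : ∀ i, ∃ x : M i, x ≠ 1 := fun i => exists_ne 1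
  have B : ¬ ((∃ i, 3 ≤ Cardinal.mk (M i)) ∨ 3 ≤ Cardinal.mk ι) →
      PalWidthLe (M := M) 2 ∧ ¬ PalWidthLe (M := M) 1 := by
    intro h
    push Not at h
    refine ⟨PalW.width_two ?_ ?_, ?_⟩
    · intro i j k h1 h2
      by_contra h3
      exact absurd (PalW.three_le_of i j k h1 h3 h2.symm) (not_le.2 h.2)
    · intro i x y hx hy
      by_contra h3
      exact absurd (PalW.three_le_of x y 1 h3 hx hy) (not_le.2 (h.1 i))
    · obtain ⟨x, hx⟩ := hne i₀
      obtain ⟨y, hy⟩ := hne j₀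
      exact PalW.not_width_one ⟨i₀, x⟩ ⟨j₀, y⟩ hx hy hij
  refine ⟨⟨fun h => ?_, ?_⟩, B⟩
  · by_contra hc
    exact h 2 (B hc).1
  · rintro (⟨i, hi⟩ | h3) k
    · obtain ⟨x, hx⟩ := hne i
      obtain ⟨y, hy1, hyx⟩ := Cardinal.exists_ne_ne_of_three_le hi 1 x
      obtain ⟨j, hj⟩ : ∃ j, i ≠ j := by
        by_cases h : i = i₀
        · exact ⟨j₀, h ▸ hij⟩
        · exact ⟨i₀, h⟩
      obtain ⟨z, hz⟩ := hne j
      exact PalW.infinite_width ⟨i, x⟩ ⟨i, y⟩ ⟨j, z⟩ hx hy1 hz hj hj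
        (fun e => hyx (by simpa using e.symm)) k
    · obtain ⟨k₀, hk1, hk2⟩ := Cardinal.exists_ne_ne_of_three_le h3 i₀ j₀
      obtain ⟨x, hx⟩ := hne i₀
      obtain ⟨y, hy⟩ := hne j₀
      obtain ⟨z, hz⟩ := hne k₀
      exact PalW.infinite_width ⟨i₀, x⟩ ⟨j₀, y⟩ ⟨k₀, z⟩ hx hy hz hk1.symm hk2.symm
        (fun e => hij (congrArg Sigma.fst e)) k
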